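/- Let ε > 0, let n ≥ 1 be a natural number, and set δ := (1+ε)^(1/(2n)) − 1. Consider the biobjective instance with the 3n+1 solutions x⁰, x¹,…,xⁿ, x̄¹,…,x̄ⁿ, x̃¹,…,x̃ⁿ and objective values f(x⁰) = (1, (1+ε)ⁿ), f(xⁱ) = (3i+1, (1+ε)^(n−i)·(1+δ)ⁱ), f(x̄ⁱ) = (3i, (1+ε)^(n−i)·(1+δ)^(i−1)), f(x̃ⁱ) = (3i+2, (1+ε)^(n−i)/(1+δ)ⁱ) for i = 1,…,n. Then for each i ∈ {1,…,n}, the only solutions that one-exact (1+ε)-dominate x̃ⁱ are xⁱ, x̄ⁱ, and x̃ⁱ itself; consequently, every one-exact (1+ε)-approximation set contains at least one of xⁱ, x̄ⁱ, x̃ⁱ for each i. -/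

import Mathlib

/-- The feasible set of the instance: `x⁰` together with `x¹,…,xⁿ`, `x̄¹,…,x̄ⁿ`, `x̃¹,…,x̃ⁿ`
(an element `i : Fin n` represents the index `i+1 ∈ {1,…,n}`). -/
abbrev XSpace (n : ℕ) := Unit ⊕ Fin n ⊕ Fin n ⊕ Fin n

/-- `x⁰`. -/
abbrev x0 (n : ℕ) : XSpace n := Sum.inl ()
/-- `xⁱ⁺¹`. -/
abbrev xP (n : ℕ) (i : Fin n) : XSpace n := Sum.inr (Sum.inl i)
/-- `x̄ⁱ⁺¹`. -/
abbrev xB (n : ℕ) (i : Fin n) : XSpace n := Sum.inr (Sum.inr (Sum.inl i))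
/-- `x̃ⁱ⁺¹`. -/
abbrev xT (n : ℕ) (i : Fin n) : XSpace n := Sum.inr (Sum.inr (Sum.inr i))

/-- The objective functions of the instance. -/
noncomputable def objf (n : ℕ) (ε δ : ℝ) : XSpace n → Fin 2 → ℝ
  | Sum.inl _ => ![1, (1 + ε) ^ n]
  | Sum.inr (Sum.inl i) =>
      ![((3 * ((i : ℕ) + 1) + 1 : ℕ) : ℝ),
        (1 + ε) ^ (n - ((i : ℕ) + 1)) * (1 + δ) ^ ((i : ℕ) + 1)]
  | Sum.inr (Sum.inr (Sum.inl i)) =>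
      ![((3 * ((i : ℕ) + 1) : ℕ) : ℝ),
        (1 + ε) ^ (n - ((i : ℕ) + 1)) * (1 + δ) ^ (i : ℕ)]
  | Sum.inr (Sum.inr (Sum.inr i)) =>
      ![((3 * ((i : ℕ) + 1) + 2 : ℕ) : ℝ),
        (1 + ε) ^ (n - ((i : ℕ) + 1)) / (1 + δ) ^ ((i : ℕ) + 1)]

/-- `x` one-exact `(1+ε)`-dominates `x'`. -/
def OneExactDom (n : ℕ) (ε δ : ℝ) (x x' : XSpace n) : Prop :=
  objf n ε δ x 0 ≤ objf n ε δ x' 0 ∧ objf n ε δ x 1 ≤ (1 + ε) * objf n ε δ x' 1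

/-- `P` is a one-exact `(1+ε)`-approximation set for the instance. -/
def OneExactApproxSet (n : ℕ) (ε δ : ℝ) (P : Finset (XSpace n)) : Prop :=
  ∀ x' : XSpace n, ∃ x ∈ P, OneExactDom n ε δ x x'

/-- Lowering the index by at least one raises `a ^ (n - m) / d ^ m` by a factor larger than `a`. -/
theorem mul_pow_sub_div_pow_lt {a d : ℝ} (ha : 1 < a) (hd : 1 < d) {n k m : ℕ}
    (hkm : k < m) (hmn : m ≤ n) :
    a * (a ^ (n - m) / d ^ m) < a ^ (n - k) / d ^ k := by
  have hd0 : 0 < d := one_pos.trans hd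
  have ha0 : 0 < a := one_pos.trans ha
  calc a * (a ^ (n - m) / d ^ m) = a ^ (n - m + 1) / d ^ m := by rw [pow_succ']; ring
    _ < a ^ (n - m + 1) / d ^ k :=
        div_lt_div_of_pos_left (pow_pos ha0 _) (pow_pos hd0 _) (pow_lt_pow_right₀ hd hkm)
    _ ≤ a ^ (n - k) / d ^ k :=
        div_le_div_of_nonneg_right (pow_le_pow_right₀ ha.le (by omega)) (pow_pos hd0 _).le

theorem eq_of_oneExactDom_xT {n : ℕ} {ε δ : ℝ} (hε : 0 < ε) (hδ : 0 < δ) {i : Fin n}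
    {y : XSpace n} (h : OneExactDom n ε δ y (xT n i)) :
    y = xP n i ∨ y = xB n i ∨ y = xT n i := by
  have ha : 1 < 1 + ε := by linarith
  have hd : 1 < 1 + δ := by linarith
  have ha0 : 0 < 1 + ε := by linarith
  have key : ∀ k < (i : ℕ) + 1, ∀ v : ℝ, (1 + ε) ^ (n - k) / (1 + δ) ^ k ≤ v →
      ¬ v ≤ (1 + ε) * ((1 + ε) ^ (n - ((i : ℕ) + 1)) / (1 + δ) ^ ((i : ℕ) + 1)) :=
    fun k hk v hv => not_le.2 ((mul_pow_sub_div_pow_lt ha hd hk i.isLt).trans_le hv)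
  have hdiv : ∀ k l : ℕ, (1 + ε) ^ (n - k) / (1 + δ) ^ k ≤ (1 + ε) ^ (n - k) * (1 + δ) ^ l :=
    fun k l => (div_le_self (pow_pos ha0 _).le (one_le_pow₀ hd.le)).trans
      (le_mul_of_one_le_right (pow_pos ha0 _).le (one_le_pow₀ hd.le))
  obtain ⟨h0, h1⟩ := h
  rcases y with _ | j | j | j <;>
    simp only [objf, Matrix.cons_val_zero, Matrix.cons_val_one, Nat.cast_le] at h0 h1
  · exact absurd h1 (key 0 (by omega) _ (by simp))
  · have hij : j = i := by
      by_contra hne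
      exact key (j + 1) (by omega) _ (hdiv _ _) h1
    exact Or.inl (by rw [hij])
  · have hij : j = i := by
      by_contra hne
      exact key (j + 1) (by omega) _ (hdiv _ _) h1
    exact Or.inr (Or.inl (by rw [hij]))
  · have hij : j = i := by
      by_contra hne
      exact key (j + 1) (by omega) _ le_rfl h1
    exact Or.inr (Or.inr (by rw [hij]))

theorem stmt_14 (ε : ℝ) (hε : 0 < ε) (n : ℕ) (hn : 1 ≤ n)
    (δ : ℝ) (hδ : δ = (1 + ε) ^ ((1 : ℝ) / (2 * n)) - 1) :
    -- the only solutions that one-exact (1+ε)-dominate x̃ⁱ are xⁱ, x̄ⁱ, and x̃ⁱ itself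
    (∀ i : Fin n, ∀ y : XSpace n,
      OneExactDom n ε δ y (xT n i) → y = xP n i ∨ y = xB n i ∨ y = xT n i) ∧
    -- consequently, every one-exact (1+ε)-approximation set contains one of them
    (∀ P : Finset (XSpace n), OneExactApproxSet n ε δ P →
      ∀ i : Fin n, xP n i ∈ P ∨ xB n i ∈ P ∨ xT n i ∈ P) := by
  have hδ0 : 0 < δ := by
    have hn0 : (0 : ℝ) < n := by exact_mod_cast hn
    have := Real.one_lt_rpow (show 1 < 1 + ε by linarith)
      (show (0 : ℝ) < 1 / (2 * n) by positivity)
    linarith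
  refine ⟨fun i y h => eq_of_oneExactDom_xT hε hδ0 h, fun P hP i => ?_⟩
  obtain ⟨y, hyP, hy⟩ := hP (xT n i)
  rcases eq_of_oneExactDom_xT hε hδ0 hy with rfl | rfl | rfl
  · exact Or.inl hyP
  · exact Or.inr (Or.inl hyP)
  · exact Or.inr (Or.inr hyP)
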